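/- Fix an integer n ≥ 1 and let C be the nonnegatively graded cochain complex of abelian groups described in the context (the model hos*(S^{2n+1}) for the S¹-homotopy orbits of the free loop space of the (2n+1)-sphere). Then for every degree j ≥ 0 there is an isomorphism of abelian groups H^j(C) ≅ (⊕ ℤ, the sum over all pairs (k,m) ∈ ℕ² with 2k + 2nm = j and with k = 0 or m = 0) ⊕ (⊕ ℤ/mℤ, the sum over all pairs (k,m) ∈ ℕ² with 2k + 2nm = j and with k ≥ 1 and m ≥ 1). (This computes the integral cohomology H^*((ℒS^{2n+1})_{hS¹}; ℤ) of the homotopy orbit space of the circle action on the free loop space of S^{2n+1}.) -/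

import Mathlib

/-!
The model `hos^*(S^{2n+1}) = (Λυ ⊗ Λz ⊗ Γ(sz), D̃)` for the `S¹`-homotopy orbits of the
free loop space of the `(2n+1)`-sphere, and the computation of its integral cohomology.
-/

namespace HOSModel

/-- Generators `(k, ε, m)`, corresponding to `υ^k ⊗ z^ε ⊗ sz(m)` with `υ` of degree 2,
`z` of degree `2n+1` and `sz` of degree `2n`. -/
abbrev Gen : Type := ℕ × Bool × ℕ

/-- The degree of a generator: `deg (k, ε, m) = 2k + (2n+1)ε + 2nm`. -/
def deg (n : ℕ) : Gen → ℤ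
  | (k, ε, m) => 2 * k + (if ε then (2 * n + 1 : ℤ) else 0) + 2 * n * m

/-- The underlying free abelian group, with basis all the generators. -/
abbrev W : Type := Gen →₀ ℤ

/-- The value of the differential on each generator:
`D(k,0,m) = 0` and `D(k,1,m) = (m+1)·(k+1,0,m+1)`. -/
noncomputable def dGen : Gen → W
  | (_, false, _) => 0
  | (k, true, m) => ((m : ℤ) + 1) • Finsupp.single (k + 1, false, m + 1) 1

/-- The differential `D` (of degree `+1` with respect to `deg`). -/
noncomputable def D : W →ₗ[ℤ] W := Finsupp.linearCombination ℤ dGen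

/-- The degree-`j` homogeneous component of the complex. -/
noncomputable def V (n : ℕ) (j : ℤ) : Submodule ℤ W :=
  Finsupp.supported ℤ ℤ {g | deg n g = j}

/-- The degree-`j` cocycles. -/
noncomputable def Zc (n : ℕ) (j : ℤ) : Submodule ℤ W := V n j ⊓ LinearMap.ker D

/-- The degree-`j` coboundaries. -/
noncomputable def Bd (n : ℕ) (j : ℤ) : Submodule ℤ W := (V n (j - 1)).map D

/-- The degree-`j` coboundaries, viewed inside the cocycles. -/
noncomputable def Bd' (n : ℕ) (j : ℤ) : Submodule ℤ (Zc n j) :=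
  (Bd n j).comap (Zc n j).subtype

/-- The degree-`j` cohomology `H^j = Z^j / B^j`. -/
noncomputable abbrev H (n : ℕ) (j : ℤ) : Type := Zc n j ⧸ Bd' n j

end HOSModel

namespace HOSModel

lemma D_single (g : Gen) (a : ℤ) : D (Finsupp.single g a) = a • dGen g := by
  simp [D]

lemma D_apply (y : W) (g : Gen) :
    D y g = match g with
      | (k + 1, false, m + 1) => ((m : ℤ) + 1) * y (k, true, m)
      | _ => 0 := by
  induction y using Finsupp.induction_linear with
  | zero => rw [map_zero]; split <;> simp
  | add x y hx hy =>
    rw [map_add, Finsupp.add_apply, hx, hy]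
    split <;> simp [mul_add]
  | single h a =>
    obtain ⟨k', ε, m'⟩ := h
    rw [D_single]
    cases ε
    · split <;> simp [dGen]
    · split
      · rename_i k m
        by_cases h : k' = k ∧ m' = m
        · obtain ⟨rfl, rfl⟩ := h
          simp [dGen]
          ring
        · simp [dGen, h]
      · rename_i h
        have : (k' + 1, false, m' + 1) ≠ g := fun e => h k' m' e.symm
        simp [dGen, this]

lemma D_apply_succ (y : W) (k m : ℕ) :
    D y (k + 1, false, m + 1) = ((m : ℤ) + 1) * y (k, true, m) := by
  rw [D_apply]

lemma D_apply_eq_zero (y : W) (k m : ℕ) (h : k = 0 ∨ m = 0) : D y (k, false, m) = 0 := by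
  rw [D_apply]
  rcases h with rfl | rfl
  · rfl
  · cases k <;> rfl

lemma D_eq_zero_iff (x : W) : D x = 0 ↔ ∀ k m, x (k, true, m) = 0 := by
  constructor
  · intro h k m
    have h1 := D_apply_succ x k m
    rw [h, Finsupp.zero_apply] at h1
    rcases mul_eq_zero.1 h1.symm with h2 | h2
    · omega
    · exact h2
  · intro h
    ext g
    rw [D_apply]
    split <;> simp [h]

lemma mem_Zc_iff (n : ℕ) (j : ℤ) (x : W) :
    x ∈ Zc n j ↔ (∀ g, deg n g ≠ j → x g = 0) ∧ ∀ k m, x (k, true, m) = 0 := by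
  rw [Zc, Submodule.mem_inf, LinearMap.mem_ker, D_eq_zero_iff, V, Finsupp.mem_supported']
  rfl

lemma mem_Bd_iff (n : ℕ) (j : ℤ) (x : W) (hx : x ∈ Zc n j) :
    x ∈ Bd n j ↔ (∀ k m, k = 0 ∨ m = 0 → x (k, false, m) = 0) ∧
      ∀ k m : ℕ, 1 ≤ k → 1 ≤ m → (m : ℤ) ∣ x (k, false, m) := by
  constructor
  · rintro ⟨y, -, rfl⟩
    refine ⟨fun k m h => D_apply_eq_zero y k m h, fun k m hk hm => ?_⟩
    obtain ⟨k, rfl⟩ := Nat.exists_eq_add_of_le' hk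
    obtain ⟨m, rfl⟩ := Nat.exists_eq_add_of_le' hm
    rw [D_apply_succ]
    exact ⟨y (k, true, m), by push_cast; rfl⟩
  · rintro ⟨h0, hdvd⟩
    rw [mem_Zc_iff] at hx
    rw [← Finsupp.sum_single x]
    refine Submodule.sum_mem _ fun g hg => ?_
    rw [Finsupp.mem_support_iff] at hg
    obtain ⟨k, ε, m⟩ := g
    cases ε
    · rcases k with _ | k
      · exact absurd (h0 0 m (Or.inl rfl)) hg
      rcases m with _ | m
      · exact absurd (h0 (k + 1) 0 (Or.inr rfl)) hg
      obtain ⟨c, hc⟩ := hdvd (k + 1) (m + 1) (by omega) (by omega)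
      have hdeg : deg n (k + 1, false, m + 1) = j := by
        by_contra h
        exact hg (hx.1 _ h)
      refine ⟨Finsupp.single (k, true, m) c, ?_, ?_⟩
      · refine Finsupp.single_mem_supported ℤ c ?_
        simp only [deg, Set.mem_ofPred_eq] at hdeg ⊢
        rw [← hdeg]
        push_cast
        simp
        ring
      · rw [D_single, hc]
        rw [dGen, smul_smul, mul_comm, Nat.cast_succ, Finsupp.smul_single_one]
    · exact absurd (hx.2 k m) hg

/-- Pairs `(k, m)` of degree `j` indexing the free summands of the cohomology. -/
abbrev FreeIdx (n : ℕ) (j : ℤ) : Type :=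
  {q : ℕ × ℕ // 2 * (q.1 : ℤ) + 2 * n * q.2 = j ∧ (q.1 = 0 ∨ q.2 = 0)}

/-- Pairs `(k, m)` of degree `j` indexing the torsion summands of the cohomology. -/
abbrev TorIdx (n : ℕ) (j : ℤ) : Type :=
  {q : ℕ × ℕ // 2 * (q.1 : ℤ) + 2 * n * q.2 = j ∧ 1 ≤ q.1 ∧ 1 ≤ q.2}

/-- The generator `υ^k ⊗ 1 ⊗ sz(m)` attached to a pair `(k, m)` satisfying `p`. -/
def evenGen {p : ℕ × ℕ → Prop} (q : Subtype p) : Gen := (q.1.1, false, q.1.2)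

lemma evenGen_injective {p : ℕ × ℕ → Prop} : Function.Injective (evenGen (p := p)) := by
  rintro ⟨⟨k, m⟩, hq⟩ ⟨⟨k', m'⟩, hq'⟩ h
  simpa [evenGen] using h

/-- The coefficients of an element of the complex at the generators `υ^k ⊗ 1 ⊗ sz(m)`. -/
noncomputable def coeffs (p : ℕ × ℕ → Prop) : W →+ DirectSum (Subtype p) fun _ => ℤ :=
  ((finsuppLEquivDirectSum ℤ ℤ (Subtype p)).toLinearMap ∘ₗ
    Finsupp.lcomapDomain evenGen evenGen_injective).toAddMonoidHom

lemma coeffs_apply (p : ℕ × ℕ → Prop) (x : W) (q : Subtype p) :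
    coeffs p x q = x (evenGen q) := by
  rfl

/-- The projection of a cocycle to its free coefficients and its torsion coefficients. -/
noncomputable def cohomologyProj (n : ℕ) (j : ℤ) :
    Zc n j →+ (DirectSum (FreeIdx n j) fun _ => ℤ) ×
      (DirectSum (TorIdx n j) fun q => ZMod q.1.2) :=
  ((coeffs _).prod
    ((DirectSum.map fun q : TorIdx n j => Int.castAddHom (ZMod q.1.2)).comp (coeffs _))).comp
    (Zc n j).subtype.toAddMonoidHom

lemma cohomologyProj_fst_apply (n : ℕ) (j : ℤ) (x : Zc n j) (q : FreeIdx n j) :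
    (cohomologyProj n j x).1 q = x.1 (evenGen q) := by
  rfl

lemma cohomologyProj_snd_apply (n : ℕ) (j : ℤ) (x : Zc n j) (q : TorIdx n j) :
    (cohomologyProj n j x).2 q = (x.1 (evenGen q) : ZMod q.1.2) := by
  rfl

lemma cohomologyProj_eq_zero_iff (n : ℕ) (j : ℤ) (x : Zc n j) :
    cohomologyProj n j x = 0 ↔ x ∈ Bd' n j := by
  have hdeg : ∀ k m : ℕ, 2 * (k : ℤ) + 2 * n * m ≠ j → x.1 (k, false, m) = 0 := fun k m h =>
    ((mem_Zc_iff n j x.1).1 x.2).1 _ (by simpa [deg] using h)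
  rw [Bd', Submodule.mem_comap, Submodule.subtype_apply, mem_Bd_iff n j _ x.2]
  constructor
  · intro h
    refine ⟨fun k m hkm => ?_, fun k m hk hm => ?_⟩
    · by_cases hj : 2 * (k : ℤ) + 2 * n * m = j
      · have := cohomologyProj_fst_apply n j x ⟨(k, m), hj, hkm⟩
        rw [h] at this
        exact this.symm
      · exact hdeg k m hj
    · by_cases hj : 2 * (k : ℤ) + 2 * n * m = j
      · have := cohomologyProj_snd_apply n j x ⟨(k, m), hj, hk, hm⟩
        rw [h] at this
        exact (ZMod.intCast_zmod_eq_zero_iff_dvd _ _).1 this.symm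
      · rw [hdeg k m hj]
        exact dvd_zero _
  · rintro ⟨h0, hdvd⟩
    refine Prod.ext (DFinsupp.ext fun q => ?_) (DFinsupp.ext fun q => ?_)
    · exact (cohomologyProj_fst_apply n j x q).trans (h0 _ _ q.2.2)
    · exact (cohomologyProj_snd_apply n j x q).trans
        ((ZMod.intCast_zmod_eq_zero_iff_dvd _ _).2 (hdvd _ _ q.2.2.1 q.2.2.2))

lemma mapDomain_evenGen_mem_Zc (n : ℕ) (j : ℤ) {p : ℕ × ℕ → Prop}
    (hp : ∀ q, p q → 2 * (q.1 : ℤ) + 2 * n * q.2 = j) (f : Subtype p →₀ ℤ) :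
    Finsupp.mapDomain evenGen f ∈ Zc n j := by
  rw [mem_Zc_iff]
  refine ⟨fun g hg => Finsupp.mapDomain_of_notMem_range _ _ ?_,
    fun k m => Finsupp.mapDomain_of_notMem_range _ _ ?_⟩
  · rintro ⟨q, rfl⟩
    exact hg (by simpa [deg, evenGen] using hp _ q.2)
  · rintro ⟨q, hq⟩
    simp [evenGen] at hq

lemma mapDomain_evenGen_apply_of_disjoint {p r : ℕ × ℕ → Prop} (hpr : ∀ q, p q → ¬ r q)
    (f : Subtype p →₀ ℤ) (q : Subtype r) : Finsupp.mapDomain evenGen f (evenGen q) = 0 := by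
  refine Finsupp.mapDomain_of_notMem_range _ _ ?_
  rintro ⟨⟨⟨k, m⟩, hk⟩, h⟩
  obtain ⟨⟨k', m'⟩, hk'⟩ := q
  simp only [evenGen, Prod.mk.injEq, true_and] at h
  obtain ⟨rfl, rfl⟩ := h
  exact hpr _ hk hk'

lemma cohomologyProj_surjective (n : ℕ) (j : ℤ) :
    Function.Surjective (cohomologyProj n j) := by
  rintro ⟨a, b⟩
  obtain ⟨b, rfl⟩ := (DirectSum.map_surjective
    (fun q : TorIdx n j => Int.castAddHom (ZMod q.1.2))).2
    (fun q => ZMod.intCast_surjective) b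
  obtain ⟨f, rfl⟩ := (finsuppLEquivDirectSum ℤ ℤ (FreeIdx n j)).surjective a
  obtain ⟨g, rfl⟩ := (finsuppLEquivDirectSum ℤ ℤ (TorIdx n j)).surjective b
  refine ⟨⟨Finsupp.mapDomain evenGen f + Finsupp.mapDomain evenGen g,
    add_mem (mapDomain_evenGen_mem_Zc n j (fun q h => h.1) f)
      (mapDomain_evenGen_mem_Zc n j (fun q h => h.1) g)⟩,
    Prod.ext (DFinsupp.ext fun q => ?_) (DFinsupp.ext fun q => ?_)⟩
  · refine (cohomologyProj_fst_apply n j _ q).trans ?_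
    rw [Finsupp.add_apply, Finsupp.mapDomain_apply evenGen_injective,
      mapDomain_evenGen_apply_of_disjoint (fun q h h' => by omega), add_zero]
    rfl
  · refine (cohomologyProj_snd_apply n j _ q).trans ?_
    rw [Finsupp.add_apply, Finsupp.mapDomain_apply evenGen_injective,
      mapDomain_evenGen_apply_of_disjoint (fun q h h' => by omega), zero_add]
    rfl

end HOSModel

open HOSModel in
/-- For `n ≥ 1` and every degree `j ≥ 0`, the degree-`j` cohomology of `hos^*(S^{2n+1})`
(which computes `H^j((ℒS^{2n+1})_{hS¹}; ℤ)`) is isomorphic, as an abelian group, to the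
direct sum of one copy of `ℤ` for each pair `(k,m)` with `2k + 2nm = j` and `k = 0` or
`m = 0`, and one copy of `ℤ/mℤ` for each pair `(k,m)` with `2k + 2nm = j`, `k ≥ 1` and
`m ≥ 1`. -/
theorem integral_cohomology_homotopy_orbits_free_loops_odd_sphere
    (n : ℕ) (hn : 1 ≤ n) (j : ℤ) (hj : 0 ≤ j) :
    Nonempty (H n j ≃+
      (DirectSum {q : ℕ × ℕ // 2 * (q.1 : ℤ) + 2 * n * q.2 = j ∧ (q.1 = 0 ∨ q.2 = 0)}
        fun _ => ℤ) ×
      (DirectSum {q : ℕ × ℕ // 2 * (q.1 : ℤ) + 2 * n * q.2 = j ∧ 1 ≤ q.1 ∧ 1 ≤ q.2}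
        fun q => ZMod q.1.2)) := by
  have hker : (Bd' n j) = LinearMap.ker (cohomologyProj n j).toIntLinearMap := by
    ext x
    exact (cohomologyProj_eq_zero_iff n j x).symm
  exact ⟨((Submodule.quotEquivOfEq _ _ hker).trans
    ((cohomologyProj n j).toIntLinearMap.quotKerEquivOfSurjective
      (cohomologyProj_surjective n j))).toAddEquiv⟩
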